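/- First-mover advantage for low defense cost: assume V ≠ ∅, pa ≠ C_e − C0 for every e ∈ E, and ∑_{e∈V} pd/(C_e−C0) < 1. Then for every Nash equilibrium of the normal-form game Γ and every SPE of the sequential game Γ̃, the defender's on-path SPE utility strictly exceeds the defender's NE utility (indeed −C0 − pd·∑_{e∈V}(C_e−pa−C0)/(C_e−C0) > −C0 − |V|·pd), while the attacker's equilibrium utility is C0 in both games. -/

import Mathlib

open Finset

noncomputable section

namespace SecGame

variable {E : Type*} [Fintype E] [DecidableEq E]

/-- Usage cost after the attacker–defender interaction. -/
def usageCost (C0 : ℝ) (Ce : E → ℝ) (sd : Finset E) : Option E → ℝ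
  | some e => if e ∈ sd then C0 else Ce e
  | none => C0

/-- Defender mixed strategy over subsets of facilities. -/
def IsDefMixed (σd : Finset E → ℝ) : Prop :=
  (∀ sd, 0 ≤ σd sd) ∧ ∑ sd : Finset E, σd sd = 1

/-- Attacker mixed strategy over `E ∪ {∅}`. -/
def IsAtkMixed (σa : Option E → ℝ) : Prop :=
  (∀ sa, 0 ≤ σa sa) ∧ ∑ sa : Option E, σa sa = 1

/-- Defender expected utility. -/
def Ud (C0 : ℝ) (Ce : E → ℝ) (pd : ℝ) (σd : Finset E → ℝ) (σa : Option E → ℝ) : ℝ :=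
  ∑ sd : Finset E, ∑ sa : Option E,
    σd sd * σa sa * (-(usageCost C0 Ce sd sa) - pd * (sd.card : ℝ))

/-- Attacker expected utility. -/
def Ua (C0 : ℝ) (Ce : E → ℝ) (pa : ℝ) (σd : Finset E → ℝ) (σa : Option E → ℝ) : ℝ :=
  ∑ sd : Finset E, ∑ sa : Option E,
    σd sd * σa sa * (usageCost C0 Ce sd sa - pa * (if sa = none then 0 else 1))

/-- Security effort vector induced by a defender mixed strategy. -/
def effort (σd : Finset E → ℝ) (e : E) : ℝ :=
  ∑ sd ∈ Finset.univ.filter (fun sd => e ∈ sd), σd sd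

/-- Nash equilibrium of the normal form game Γ. -/
def IsNE (C0 : ℝ) (Ce : E → ℝ) (pa pd : ℝ) (σd : Finset E → ℝ) (σa : Option E → ℝ) : Prop :=
  IsDefMixed σd ∧ IsAtkMixed σa ∧
  (∀ σd', IsDefMixed σd' → Ud C0 Ce pd σd' σa ≤ Ud C0 Ce pd σd σa) ∧
  (∀ σa', IsAtkMixed σa' → Ua C0 Ce pa σd σa' ≤ Ua C0 Ce pa σd σa)

/-- Security effort vectors in the unit box `[0,1]^E`. -/
def InBox (ρ : E → ℝ) : Prop := ∀ e, 0 ≤ ρ e ∧ ρ e ≤ 1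

/-- Defender expected utility as a function of the security effort vector. -/
def UdRho (C0 : ℝ) (Ce : E → ℝ) (pd : ℝ) (ρ : E → ℝ) (σa : Option E → ℝ) : ℝ :=
  -(∑ e : E, (ρ e * ((C0 - Ce e) * σa (some e) + pd) + Ce e * σa (some e))) - C0 * σa none

/-- Attacker expected utility as a function of the security effort vector. -/
def UaRho (C0 : ℝ) (Ce : E → ℝ) (pa : ℝ) (ρ : E → ℝ) (σa : Option E → ℝ) : ℝ :=
  (∑ e : E, (ρ e * (C0 - Ce e) * σa (some e) + Ce e * σa (some e))) + C0 * σa none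
    - pa * ∑ e : E, σa (some e)

/-- Threshold security effort for a vulnerable facility. -/
def rhoHat (C0 : ℝ) (Ce : E → ℝ) (pa : ℝ) (e : E) : ℝ := (Ce e - pa - C0) / (Ce e - C0)

/-- Subgame perfect equilibrium of the sequential game Γ̃. -/
def IsSPE (C0 : ℝ) (Ce : E → ℝ) (pa pd : ℝ) (ρstar : E → ℝ)
    (σastar : (E → ℝ) → Option E → ℝ) : Prop :=
  InBox ρstar ∧
  (∀ ρ, InBox ρ → IsAtkMixed (σastar ρ) ∧
    ∀ σa, IsAtkMixed σa → UaRho C0 Ce pa ρ σa ≤ UaRho C0 Ce pa ρ (σastar ρ)) ∧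
  (∀ ρ, InBox ρ → UdRho C0 Ce pd ρ (σastar ρ) ≤ UdRho C0 Ce pd ρstar (σastar ρstar))

/-- Expectation under a defender mixed strategy of a function affine in the indicators `e ∈ sd`. -/
theorem sum_mul_affine_eq {σd : Finset E → ℝ} (hσ : IsDefMixed σd) (a : ℝ) (α β : E → ℝ) :
    ∑ sd, σd sd * (a + ∑ e, (α e + β e * (if e ∈ sd then 1 else 0)))
      = a + ∑ e, (α e + β e * effort σd e) := by
  have h : ∀ e, ∑ sd, σd sd * (α e + β e * (if e ∈ sd then 1 else 0))
      = α e + β e * effort σd e := by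
    intro e
    simp only [mul_add, Finset.sum_add_distrib, ← Finset.sum_mul, hσ.2, one_mul]
    rw [effort, Finset.sum_filter, Finset.mul_sum]
    congr 1
    refine Finset.sum_congr rfl fun sd _ => ?_
    split_ifs <;> ring
  simp only [mul_add (σd _) a, Finset.mul_sum]
  rw [Finset.sum_add_distrib, ← Finset.sum_mul, hσ.2, one_mul, Finset.sum_comm]
  simp only [h]

theorem IsDefMixed.effort_nonneg {σd : Finset E → ℝ} (hσ : IsDefMixed σd) (e : E) :
    0 ≤ effort σd e :=
  Finset.sum_nonneg fun sd _ => hσ.1 sd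

theorem IsDefMixed.effort_le_one {σd : Finset E → ℝ} (hσ : IsDefMixed σd) (e : E) :
    effort σd e ≤ 1 := by
  rw [← hσ.2]
  exact Finset.sum_le_sum_of_subset_of_nonneg (Finset.filter_subset _ _) fun sd _ _ => hσ.1 sd

theorem isDefMixed_single (s : Finset E) : IsDefMixed (Pi.single s (1 : ℝ)) := by
  refine ⟨fun sd => ?_, by simp⟩
  by_cases h : sd = s
  · subst h; simp
  · simp [h]

theorem effort_single (s : Finset E) (e : E) :
    effort (Pi.single s (1 : ℝ)) e = if e ∈ s then 1 else 0 := by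
  rw [effort, Finset.sum_filter, Finset.sum_eq_single s] <;> simp +contextual

theorem isAtkMixed_single (a : Option E) : IsAtkMixed (Pi.single a (1 : ℝ)) := by
  refine ⟨fun b => ?_, by simp⟩
  by_cases h : b = a
  · subst h; simp
  · simp [h]

theorem IsAtkMixed.none_eq {F : Type*} [Fintype F] {σa : Option F → ℝ} (hσ : IsAtkMixed σa) :
    σa none = 1 - ∑ e, σa (some e) := by
  have := hσ.2
  rw [Fintype.sum_option] at this
  linarith

theorem UdRho_eq {F : Type*} [Fintype F] {C0 pd : ℝ} {Ce ρ : F → ℝ} {σa : Option F → ℝ}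
    (hσ : IsAtkMixed σa) :
    UdRho C0 Ce pd ρ σa
      = -C0 - ∑ e, (σa (some e) * (Ce e - C0) * (1 - ρ e) + pd * ρ e) := by
  rw [UdRho, hσ.none_eq, mul_sub, Finset.mul_sum]
  have : ∑ e, (σa (some e) * (Ce e - C0) * (1 - ρ e) + pd * ρ e)
      = ∑ e, (ρ e * ((C0 - Ce e) * σa (some e) + pd) + Ce e * σa (some e))
        - ∑ e, C0 * σa (some e) := by
    rw [← Finset.sum_sub_distrib]
    exact Finset.sum_congr rfl fun e _ => by ring
  rw [this]
  ring

theorem UaRho_eq {F : Type*} [Fintype F] {C0 pa : ℝ} {Ce ρ : F → ℝ} {σa : Option F → ℝ}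
    (hσ : IsAtkMixed σa) :
    UaRho C0 Ce pa ρ σa
      = C0 + ∑ e, σa (some e) * ((Ce e - C0) * (1 - ρ e) - pa) := by
  rw [UaRho, hσ.none_eq, mul_sub, Finset.mul_sum, Finset.mul_sum]
  have : ∑ e, σa (some e) * ((Ce e - C0) * (1 - ρ e) - pa)
      = ∑ e, (ρ e * (C0 - Ce e) * σa (some e) + Ce e * σa (some e))
        - ∑ e, C0 * σa (some e) - ∑ e, pa * σa (some e) := by
    rw [← Finset.sum_sub_distrib, ← Finset.sum_sub_distrib]
    exact Finset.sum_congr rfl fun e _ => by ring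
  rw [this]
  ring

theorem Ud_eq_UdRho {C0 pd : ℝ} {Ce : E → ℝ} {σd : Finset E → ℝ} {σa : Option E → ℝ}
    (hd : IsDefMixed σd) (ha : IsAtkMixed σa) :
    Ud C0 Ce pd σd σa = UdRho C0 Ce pd (effort σd) σa := by
  have h := sum_mul_affine_eq hd (-C0) (fun e => -(σa (some e) * (Ce e - C0)))
    (fun e => σa (some e) * (Ce e - C0) - pd)
  rw [UdRho_eq ha, sub_eq_add_neg, ← Finset.sum_neg_distrib]
  convert h using 1
  · refine Finset.sum_congr rfl fun sd _ => ?_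
    have hc : (sd.card : ℝ) = ∑ e, (if e ∈ sd then (1 : ℝ) else 0) := by simp
    simp only [mul_assoc]
    rw [← Finset.mul_sum]
    congr 1
    simp only [mul_sub, Finset.sum_sub_distrib, ← Finset.sum_mul, ha.2, one_mul]
    rw [Fintype.sum_option, ha.none_eq, hc, Finset.mul_sum, sub_mul, Finset.sum_mul]
    simp only [usageCost]
    rw [sub_eq_iff_eq_add, add_assoc, ← Finset.sum_add_distrib]
    rw [one_mul, sub_add_eq_add_sub, sub_eq_iff_eq_add, add_assoc]
    congr 1
    rw [← Finset.sum_add_distrib]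
    refine Finset.sum_congr rfl fun e _ => ?_
    split_ifs <;> ring
  · congr 1
    exact Finset.sum_congr rfl fun e _ => by ring

theorem Ua_eq_UaRho {C0 pa : ℝ} {Ce : E → ℝ} {σd : Finset E → ℝ} {σa : Option E → ℝ}
    (hd : IsDefMixed σd) (ha : IsAtkMixed σa) :
    Ua C0 Ce pa σd σa = UaRho C0 Ce pa (effort σd) σa := by
  have h := sum_mul_affine_eq hd C0 (fun e => σa (some e) * (Ce e - C0 - pa))
    (fun e => -(σa (some e) * (Ce e - C0)))
  rw [UaRho_eq ha]
  convert h using 1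
  · refine Finset.sum_congr rfl fun sd _ => ?_
    simp only [mul_assoc]
    rw [← Finset.mul_sum]
    congr 1
    rw [Fintype.sum_option, ha.none_eq]
    simp only [usageCost, reduceCtorEq, if_true, if_false, mul_zero, sub_zero, mul_one]
    rw [sub_mul, Finset.sum_mul, one_mul, sub_add_eq_add_sub, sub_eq_iff_eq_add, add_assoc,
      ← Finset.sum_add_distrib]
    congr 1
    refine Finset.sum_congr rfl fun e _ => ?_
    split_ifs <;> ring
  · congr 1
    exact Finset.sum_congr rfl fun e _ => by ring

/-- `σa` maximizes the attacker's utility against the security effort vector `ρ`. -/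
def IsAtkBestResponse (C0 : ℝ) (Ce : E → ℝ) (pa : ℝ) (ρ : E → ℝ) (σa : Option E → ℝ) : Prop :=
  IsAtkMixed σa ∧ ∀ σa', IsAtkMixed σa' → UaRho C0 Ce pa ρ σa' ≤ UaRho C0 Ce pa ρ σa

namespace IsAtkBestResponse

variable {C0 pa : ℝ} {Ce ρ : E → ℝ} {σa : Option E → ℝ}

theorem le_UaRho (h : IsAtkBestResponse C0 Ce pa ρ σa) : C0 ≤ UaRho C0 Ce pa ρ σa := by
  have := h.2 _ (isAtkMixed_single none)
  rw [UaRho_eq (isAtkMixed_single none)] at this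
  simpa using this

theorem add_gain_le_UaRho (h : IsAtkBestResponse C0 Ce pa ρ σa) (e : E) :
    C0 + ((Ce e - C0) * (1 - ρ e) - pa) ≤ UaRho C0 Ce pa ρ σa := by
  have := h.2 _ (isAtkMixed_single (some e))
  rw [UaRho_eq (isAtkMixed_single (some e)), Finset.sum_eq_single e] at this
  · simpa using this
  · intro b _ hb
    simp [hb]
  · simp

theorem slack (h : IsAtkBestResponse C0 Ce pa ρ σa) :
    σa none * (UaRho C0 Ce pa ρ σa - C0) = 0 ∧
    ∀ e, σa (some e) * (UaRho C0 Ce pa ρ σa - C0 - ((Ce e - C0) * (1 - ρ e) - pa)) = 0 := by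
  have h1 : ∀ e ∈ Finset.univ,
      0 ≤ σa (some e) * (UaRho C0 Ce pa ρ σa - C0 - ((Ce e - C0) * (1 - ρ e) - pa)) :=
    fun e _ => mul_nonneg (h.1.1 _) (by linarith [h.add_gain_le_UaRho e])
  have h2 : 0 ≤ σa none * (UaRho C0 Ce pa ρ σa - C0) :=
    mul_nonneg (h.1.1 _) (by linarith [h.le_UaRho])
  have h3 : ∑ e, σa (some e) * (UaRho C0 Ce pa ρ σa - C0 - ((Ce e - C0) * (1 - ρ e) - pa))
      = - (σa none * (UaRho C0 Ce pa ρ σa - C0)) := by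
    simp only [mul_sub (σa (some _)) (UaRho C0 Ce pa ρ σa - C0)]
    rw [Finset.sum_sub_distrib, ← Finset.sum_mul, h.1.none_eq]
    linarith [UaRho_eq (C0 := C0) (pa := pa) (Ce := Ce) (ρ := ρ) h.1]
  have h4 := Finset.sum_nonneg h1
  refine ⟨by linarith, fun e => (Finset.sum_eq_zero_iff_of_nonneg h1).1 (by linarith) e ?_⟩
  exact Finset.mem_univ e

theorem eq_zero_of_gain_neg (h : IsAtkBestResponse C0 Ce pa ρ σa) {e : E}
    (he : (Ce e - C0) * (1 - ρ e) < pa) : σa (some e) = 0 :=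
  (mul_eq_zero.1 (h.slack.2 e)).resolve_right (by linarith [h.le_UaRho])

end IsAtkBestResponse

/-- Facilities that are not vulnerable give the attacker a negative gain. -/
theorem gain_lt_of_lt {d pa r : ℝ} (hpa : 0 < pa) (hd : d < pa) (h0 : 0 ≤ r) (h1 : r ≤ 1) :
    d * (1 - r) < pa := by
  rcases le_or_gt 0 d with h | h
  · nlinarith
  · nlinarith

/-- At each facility, a best-responding defender pays the cheaper of the expected damage when it
is left unsecured and the defense cost. -/
theorem coordinate_cost_eq_min {C0 pd : ℝ} {Ce : E → ℝ} {σd : Finset E → ℝ}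
    {σa : Option E → ℝ} (hd : IsDefMixed σd) (ha : IsAtkMixed σa)
    (hbr : ∀ σd', IsDefMixed σd' → Ud C0 Ce pd σd' σa ≤ Ud C0 Ce pd σd σa) (e : E) :
    σa (some e) * (Ce e - C0) * (1 - effort σd e) + pd * effort σd e
      = min (σa (some e) * (Ce e - C0)) pd := by
  let s : Finset E := Finset.univ.filter fun e => pd < σa (some e) * (Ce e - C0)
  have h := hbr _ (isDefMixed_single s)
  rw [Ud_eq_UdRho (isDefMixed_single s) ha, Ud_eq_UdRho hd ha, UdRho_eq ha, UdRho_eq ha] at h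
  have hs : ∀ e, σa (some e) * (Ce e - C0) * (1 - effort (Pi.single s (1 : ℝ)) e)
      + pd * effort (Pi.single s (1 : ℝ)) e = min (σa (some e) * (Ce e - C0)) pd := by
    intro e
    rw [effort_single]
    by_cases he : pd < σa (some e) * (Ce e - C0)
    · simp [s, he, he.le]
    · simp [s, he, not_lt.1 he]
  simp only [hs] at h
  have hmin : ∀ e ∈ Finset.univ, min (σa (some e) * (Ce e - C0)) pd
      ≤ σa (some e) * (Ce e - C0) * (1 - effort σd e) + pd * effort σd e := by
    intro e _
    have h1 := min_le_left (σa (some e) * (Ce e - C0)) pd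
    have h2 := min_le_right (σa (some e) * (Ce e - C0)) pd
    nlinarith [hd.effort_nonneg e, hd.effort_le_one e]
  exact ((Finset.sum_eq_sum_iff_of_le hmin).1
    (le_antisymm (Finset.sum_le_sum hmin) (by linarith)) e (Finset.mem_univ e)).symm

section LowCost

variable {C0 pa pd : ℝ} {Ce : E → ℝ}

theorem IsNE.isAtkBestResponse {σd : Finset E → ℝ} {σa : Option E → ℝ}
    (h : IsNE C0 Ce pa pd σd σa) : IsAtkBestResponse C0 Ce pa (effort σd) σa := by
  obtain ⟨hd, ha, -, hbr⟩ := h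
  refine ⟨ha, fun σa' ha' => ?_⟩
  rw [← Ua_eq_UaRho hd ha, ← Ua_eq_UaRho hd ha']
  exact hbr σa' ha'

theorem IsNE.Ua_eq {σd : Finset E → ℝ} {σa : Option E → ℝ}
    (h : IsNE C0 Ce pa pd σd σa) (hpa : 0 < pa) (hpd : 0 < pd)
    (hsum : ∑ e ∈ Finset.univ.filter (fun e => C0 < Ce e - pa), pd / (Ce e - C0) < 1) :
    Ua C0 Ce pa σd σa = C0 := by
  have hb := h.isAtkBestResponse
  have hmin := coordinate_cost_eq_min h.1 h.2.1 h.2.2.1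
  rw [Ua_eq_UaRho h.1 h.2.1]
  by_contra hne
  have hlt : C0 < UaRho C0 Ce pa (effort σd) σa := lt_of_le_of_ne hb.le_UaRho (Ne.symm hne)
  have hnone : σa none = 0 := (mul_eq_zero.1 hb.slack.1).resolve_right (by linarith)
  have htot : ∑ e, σa (some e) = 1 := by linarith [hb.1.none_eq]
  have hle : ∑ e, σa (some e)
      ≤ ∑ e ∈ Finset.univ.filter (fun e => C0 < Ce e - pa), pd / (Ce e - C0) := by
    rw [Finset.sum_filter]
    refine Finset.sum_le_sum fun e _ => ?_
    have h0 := h.1.effort_nonneg e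
    have h1 := h.1.effort_le_one e
    rcases eq_or_ne (σa (some e)) 0 with hz | hz
    · rw [hz]
      split_ifs with he
      · exact div_nonneg hpd.le (by linarith)
      · exact le_rfl
    · have hg := (mul_eq_zero.1 (hb.slack.2 e)).resolve_left hz
      have hgt : pa < (Ce e - C0) * (1 - effort σd e) := by linarith
      have hV : pa < Ce e - C0 := by
        by_contra! hle
        nlinarith
      have hρ : 0 < 1 - effort σd e := by
        by_contra! hle
        nlinarith
      rw [if_pos (by linarith), le_div_iff₀ (by linarith)]
      by_contra! hcon
      have := hmin e
      rw [min_eq_right hcon.le] at this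
      nlinarith
  linarith

theorem IsNE.Ud_le {σd : Finset E → ℝ} {σa : Option E → ℝ}
    (h : IsNE C0 Ce pa pd σd σa) (hpa : 0 < pa) (hpd : 0 < pd)
    (hgen : ∀ e : E, pa ≠ Ce e - C0)
    (hsum : ∑ e ∈ Finset.univ.filter (fun e => C0 < Ce e - pa), pd / (Ce e - C0) < 1) :
    Ud C0 Ce pd σd σa
      ≤ -C0 - ((Finset.univ.filter (fun e => C0 < Ce e - pa)).card : ℝ) * pd := by
  have hb := h.isAtkBestResponse
  have hU := h.Ua_eq hpa hpd hsum
  rw [Ua_eq_UaRho h.1 h.2.1] at hU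
  rw [Ud_eq_UdRho h.1 h.2.1, UdRho_eq h.2.1, ← nsmul_eq_mul, ← Finset.sum_const,
    Finset.sum_filter]
  refine sub_le_sub_left (Finset.sum_le_sum fun e _ => ?_) _
  have h0 := h.1.effort_nonneg e
  have h1 := h.1.effort_le_one e
  split_ifs with he
  · have hg := hb.add_gain_le_UaRho e
    have hρ : 0 < effort σd e := by
      by_contra! hle
      nlinarith
    have hmin := coordinate_cost_eq_min h.1 h.2.1 h.2.2.1 e
    have hbd : pd ≤ σa (some e) * (Ce e - C0) := by
      by_contra! hlt
      rw [min_eq_left hlt.le] at hmin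
      nlinarith
    rw [hmin, min_eq_right hbd]
  · have hlt : Ce e - C0 < pa := lt_of_le_of_ne (by linarith) (hgen e).symm
    rw [hb.eq_zero_of_gain_neg (gain_lt_of_lt hpa hlt h0 h1)]
    nlinarith

/-- By securing every vulnerable facility slightly above its threshold, a defender who moves
first deters all attacks. -/
theorem IsSPE.le_UdRho {ρstar : E → ℝ} {σastar : (E → ℝ) → Option E → ℝ}
    (h : IsSPE C0 Ce pa pd ρstar σastar) (hpa : 0 < pa) (hgen : ∀ e : E, pa ≠ Ce e - C0)
    {ε : ℝ} (hε : 0 < ε) (hε1 : ε ≤ 1) :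
    -C0 - ∑ e ∈ Finset.univ.filter (fun e => C0 < Ce e - pa),
        (pd * ((Ce e - pa - C0) / (Ce e - C0)) + ε * pa * (pd / (Ce e - C0)))
      ≤ UdRho C0 Ce pd ρstar (σastar ρstar) := by
  let ρ : E → ℝ := fun e => if C0 < Ce e - pa then 1 - (1 - ε) * (pa / (Ce e - C0)) else 0
  have hbox : InBox ρ := by
    intro e
    by_cases he : C0 < Ce e - pa
    · have hq : pa / (Ce e - C0) ≤ 1 := (div_le_one (by linarith)).2 (by linarith)
      have hq0 : 0 ≤ pa / (Ce e - C0) := div_nonneg hpa.le (by linarith)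
      simp only [ρ, he, if_true]
      constructor <;> nlinarith
    · simp [ρ, he]
  have hb : IsAtkBestResponse C0 Ce pa ρ (σastar ρ) := h.2.1 ρ hbox
  have hz : ∀ e, σastar ρ (some e) = 0 := by
    intro e
    apply hb.eq_zero_of_gain_neg
    by_cases he : C0 < Ce e - pa
    · have hne : Ce e - C0 ≠ 0 := by linarith
      have : (Ce e - C0) * (1 - ρ e) = (1 - ε) * pa := by
        simp only [ρ, he, if_true]
        field_simp
        ring
      rw [this]
      nlinarith
    · exact gain_lt_of_lt hpa (lt_of_le_of_ne (by linarith) (hgen e).symm) (hbox e).1 (hbox e).2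
  refine le_of_eq_of_le ?_ (h.2.2 ρ hbox)
  rw [UdRho_eq hb.1, Finset.sum_filter]
  congr 1
  refine Finset.sum_congr rfl fun e _ => ?_
  rw [hz]
  by_cases he : C0 < Ce e - pa
  · have hne : Ce e - C0 ≠ 0 := by linarith
    simp only [ρ, he, if_true]
    field_simp
    ring
  · simp [ρ, he]

theorem IsSPE.UaRho_eq {ρstar : E → ℝ} {σastar : (E → ℝ) → Option E → ℝ}
    (h : IsSPE C0 Ce pa pd ρstar σastar) (hpa : 0 < pa) (hpd : 0 < pd)
    (hgen : ∀ e : E, pa ≠ Ce e - C0)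
    (hsum : ∑ e ∈ Finset.univ.filter (fun e => C0 < Ce e - pa), pd / (Ce e - C0) < 1) :
    UaRho C0 Ce pa ρstar (σastar ρstar) = C0 := by
  have hb : IsAtkBestResponse C0 Ce pa ρstar (σastar ρstar) := h.2.1 ρstar h.1
  set S := ∑ e ∈ Finset.univ.filter (fun e => C0 < Ce e - pa), pd / (Ce e - C0) with hS
  set m := UaRho C0 Ce pa ρstar (σastar ρstar) - C0 with hm
  by_contra hne
  have hmpos : 0 < m := by
    have := lt_of_le_of_ne hb.le_UaRho (Ne.symm hne)
    linarith
  have hm_le : m ≤ ∑ e, σastar ρstar (some e) * (Ce e - C0) * (1 - ρstar e) := by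
    rw [hm, SecGame.UaRho_eq hb.1, add_sub_cancel_left]
    refine Finset.sum_le_sum fun e _ => ?_
    nlinarith [hb.1.1 (some e)]
  have hρ : ∑ e ∈ Finset.univ.filter (fun e => C0 < Ce e - pa),
      (pd * ((Ce e - pa - C0) / (Ce e - C0)) - m * (pd / (Ce e - C0)))
        ≤ ∑ e, pd * ρstar e := by
    rw [Finset.sum_filter]
    refine Finset.sum_le_sum fun e _ => ?_
    split_ifs with he
    · have hd : 0 < Ce e - C0 := by linarith
      have hg := hb.add_gain_le_UaRho e
      have : (Ce e - pa - C0 - m) / (Ce e - C0) ≤ ρstar e := by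
        rw [div_le_iff₀ hd]
        linarith
      calc _ = pd * ((Ce e - pa - C0 - m) / (Ce e - C0)) := by ring
        _ ≤ _ := mul_le_mul_of_nonneg_left this hpd.le
    · exact mul_nonneg hpd.le (h.1 e).1
  have hκ : 0 < m * (1 - S) := mul_pos hmpos (by linarith)
  have hε : 0 < min 1 (m * (1 - S) / (2 * pa)) := lt_min one_pos (by positivity)
  have hlow := h.le_UdRho hpa hgen hε (min_le_left _ _)
  rw [UdRho_eq hb.1, Finset.sum_add_distrib, Finset.sum_add_distrib, ← Finset.mul_sum _ _ (_ * pa),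
    ← hS] at hlow
  rw [Finset.sum_sub_distrib, ← Finset.mul_sum _ _ m, ← hS] at hρ
  have hεle : min 1 (m * (1 - S) / (2 * pa)) * pa ≤ m * (1 - S) / 2 := by
    calc _ ≤ m * (1 - S) / (2 * pa) * pa :=
          mul_le_mul_of_nonneg_right (min_le_right _ _) hpa.le
      _ = _ := by field_simp
  have := mul_pos hε hpa
  nlinarith

end LowCost

/-- **First-mover advantage for relatively low defense cost (set L).**
Assume `V ≠ ∅`, `pa ≠ C_e − C0` for every `e`, and `∑_{e∈V} pd/(C_e−C0) < 1`. Then for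
every Nash equilibrium of Γ and every SPE of Γ̃, the defender's on-path SPE utility
strictly exceeds her NE utility — indeed
`−C0 − pd·∑_{e∈V}(C_e−pa−C0)/(C_e−C0) > −C0 − |V|·pd` — while the attacker's equilibrium
utility is `C0` in both games. -/
theorem first_mover_advantage_low_cost {E : Type*} [Fintype E] [DecidableEq E] [Nonempty E]
    (C0 : ℝ) (Ce : E → ℝ) (pa pd : ℝ) (hpa : 0 < pa) (hpd : 0 < pd)
    (hV : ∃ e : E, C0 < Ce e - pa)
    (hgen : ∀ e : E, pa ≠ Ce e - C0)
    (hsum : ∑ e ∈ Finset.univ.filter (fun e => C0 < Ce e - pa), pd / (Ce e - C0) < 1) :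
    (-C0 - pd * ∑ e ∈ Finset.univ.filter (fun e => C0 < Ce e - pa),
        (Ce e - pa - C0) / (Ce e - C0)
      > -C0 - ((Finset.univ.filter (fun e => C0 < Ce e - pa)).card : ℝ) * pd) ∧
    (∀ (σd : Finset E → ℝ) (σa : Option E → ℝ), IsNE C0 Ce pa pd σd σa →
      ∀ (ρstar : E → ℝ) (σastar : (E → ℝ) → Option E → ℝ),
        IsSPE C0 Ce pa pd ρstar σastar →
          UdRho C0 Ce pd ρstar (σastar ρstar) > Ud C0 Ce pd σd σa ∧
          Ua C0 Ce pa σd σa = C0 ∧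
          UaRho C0 Ce pa ρstar (σastar ρstar) = C0) := by
  obtain ⟨e₀, he₀⟩ := hV
  have hlt : ∀ ε : ℝ, ε < 1 → ∑ e ∈ Finset.univ.filter (fun e => C0 < Ce e - pa),
      (pd * ((Ce e - pa - C0) / (Ce e - C0)) + ε * pa * (pd / (Ce e - C0)))
        < ((Finset.univ.filter (fun e => C0 < Ce e - pa)).card : ℝ) * pd := by
    intro ε hε
    rw [← nsmul_eq_mul, ← Finset.sum_const]
    refine Finset.sum_lt_sum_of_nonempty ⟨e₀, by simpa using he₀⟩ fun e he => ?_
    have hd : 0 < Ce e - C0 := by linarith [(Finset.mem_filter.1 he).2]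
    have hpos : 0 < pa * (pd / (Ce e - C0)) := by positivity
    have heq : pd * ((Ce e - pa - C0) / (Ce e - C0)) = pd - pa * (pd / (Ce e - C0)) := by
      field_simp
      ring
    rw [heq]
    nlinarith
  refine ⟨?_, fun σd σa hNE ρstar σastar hSPE =>
    ⟨?_, hNE.Ua_eq hpa hpd hsum, hSPE.UaRho_eq hpa hpd hgen hsum⟩⟩
  · have := hlt 0 one_pos
    simp only [zero_mul, add_zero, ← Finset.mul_sum] at this
    linarith
  · have h1 := hSPE.le_UdRho hpa hgen (ε := 1 / 2) (by norm_num) (by norm_num)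
    have h2 := hNE.Ud_le hpa hpd hgen hsum
    have h3 := hlt (1 / 2) (by norm_num)
    linarith

end SecGame
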